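/- Let X be a real Banach space and suppose Ψ and Φ satisfy (Ψ1), (Ψ2), (Ψ3), (Φ1), (Φ2), (IB) and the uniform mountain pass geometry (MP). Then I := I_1 = Ψ − Φ admits a critical point u ∈ X with I(u) = c₀(1), where c₀ is the mountain pass value. -/

import Mathlib

open Set Filter Metric Bornology Topology

noncomputable section

variable {X : Type*} [NormedAddCommGroup X] [NormedSpace ℝ X]

/-- The functional `I_λ = λΨ − Φ`, with extended-real values. -/
def ILam (Ψ : X → EReal) (Φ : X → ℝ) (lam : ℝ) (u : X) : EReal :=
  (lam : EReal) * Ψ u - ((Φ u : ℝ) : EReal)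

/-- `u` is a critical point of `I_λ = λΨ − Φ` in the sense of Szulkin:
`λ(Ψ(v) − Ψ(u)) − Φ'(u)(v − u) ≥ 0` for all `v`. -/
def IsCriticalPoint (Ψ : X → EReal) (Φ : X → ℝ) (lam : ℝ) (u : X) : Prop :=
  ∀ v : X, 0 ≤ (lam : EReal) * (Ψ v - Ψ u) - ((fderiv ℝ Φ u (v - u) : ℝ) : EReal)

/-- The class `Γ₀` of continuous paths joining `0` to `u₀`. -/
def MPPaths (u₀ : X) : Set (ℝ → X) :=
  {γ | ContinuousOn γ (Icc 0 1) ∧ γ 0 = 0 ∧ γ 1 = u₀}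

/-- The mountain pass value `c₀(λ) = inf_{γ ∈ Γ₀} sup_{t ∈ [0,1]} I_λ(γ(t))`,
expressed as the infimum of the set of real upper bounds of `I_λ ∘ γ` over paths `γ ∈ Γ₀`. -/
def mpValue (Ψ : X → EReal) (Φ : X → ℝ) (u₀ : X) (lam : ℝ) : ℝ :=
  sInf {x : ℝ | ∃ γ ∈ MPPaths u₀,
    ∀ t ∈ Icc (0 : ℝ) 1, ILam Ψ Φ lam (γ t) ≤ (x : EReal)}


theorem ekeland_aux {M : Type*} [MetricSpace M] [CompleteSpace M] (J : M → ℝ)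
    (hJ : LowerSemicontinuous J) (c : ℝ) (hc : ∀ x, c ≤ J x) (κ : ℝ) (hκ : 0 < κ) (x₀ : M) :
    ∃ x, J x + κ * dist x x₀ ≤ J x₀ ∧ ∀ y, J y + κ * dist y x ≤ J x → y = x := by
  set S : M → Set M := fun x => {y | J y + κ * dist y x ≤ J x} with hS
  have hself : ∀ x, x ∈ S x := fun x => by simp [hS]
  have htrans : ∀ x y z, y ∈ S x → z ∈ S y → z ∈ S x := by
    intro x y z hy hz
    simp only [hS, mem_ofPred_eq] at *
    have := dist_triangle z y x
    nlinarith
  have hstep : ∀ (n : ℕ) (x : M), ∃ x' ∈ S x, ∀ y ∈ S x, J x' ≤ J y + (1/2 : ℝ) ^ n := by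
    intro n x
    have hne : (J '' S x).Nonempty := ⟨_, mem_image_of_mem J (hself x)⟩
    have hbd : BddBelow (J '' S x) := ⟨c, by rintro _ ⟨y, _, rfl⟩; exact hc y⟩
    obtain ⟨_, ⟨x', hx', rfl⟩, hlt⟩ := exists_lt_of_csInf_lt hne
      (lt_add_of_pos_right (sInf (J '' S x)) (by positivity : (0 : ℝ) < (1/2) ^ n))
    refine ⟨x', hx', fun y hy => ?_⟩
    have := csInf_le hbd (mem_image_of_mem J hy)
    linarith
  choose g hg1 hg2 using hstep
  let x : ℕ → M := fun n => Nat.rec x₀ (fun n y => g n y) n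
  have hx1 : ∀ n, x (n + 1) ∈ S (x n) := fun n => hg1 n (x n)
  have hx2 : ∀ n, ∀ y ∈ S (x n), J (x (n + 1)) ≤ J y + (1/2 : ℝ) ^ n := fun n => hg2 n (x n)
  have hmono : ∀ n m, n ≤ m → x m ∈ S (x n) := by
    intro n m hnm
    induction m, hnm using Nat.le_induction with
    | base => exact hself _
    | succ m hm ih => exact htrans _ _ _ ih (hx1 m)
  have hclosed : ∀ z, IsClosed (S z) := by
    intro z
    have : LowerSemicontinuous (fun y => J y + κ * dist y z) :=
      hJ.add (Continuous.lowerSemicontinuous (by fun_prop))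
    exact this.isClosed_preimage (J z)
  have hdist : ∀ n, ∀ y ∈ S (x (n + 1)), dist y (x (n + 1)) ≤ (1/2 : ℝ) ^ n / κ := by
    intro n y hy
    have h1 := hx2 n y (htrans _ _ _ (hx1 n) hy)
    have h2 : J y + κ * dist y (x (n + 1)) ≤ J (x (n + 1)) := hy
    rw [le_div_iff₀ hκ]
    linarith
  have hlim0 : Tendsto (fun n : ℕ => (1/2 : ℝ) ^ n / κ) atTop (𝓝 0) := by
    have := (tendsto_pow_atTop_nhds_zero_of_lt_one (r := (1/2 : ℝ)) (by norm_num)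
      (by norm_num)).div_const κ
    simpa using this
  have hcauchy : CauchySeq (fun n => x (n + 1)) :=
    cauchySeq_of_le_tendsto_0' (fun n : ℕ => (1/2 : ℝ) ^ n / κ)
      (fun n m hnm => by
        rw [dist_comm]
        exact hdist n _ (hmono (n + 1) (m + 1) (by omega))) hlim0
  obtain ⟨z, hz⟩ := cauchySeq_tendsto_of_complete hcauchy
  have hzS : ∀ n, z ∈ S (x n) := by
    intro n
    refine (hclosed (x n)).mem_of_tendsto hz ?_
    filter_upwards [eventually_ge_atTop n] with m hm
    exact hmono n (m + 1) (by omega)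
  refine ⟨z, hzS 0, fun y hy => ?_⟩
  have hyS : ∀ n, y ∈ S (x n) := fun n => htrans _ _ _ (hzS n) hy
  have h1 : Tendsto (fun n => x (n + 1)) atTop (𝓝 y) := by
    rw [tendsto_iff_dist_tendsto_zero]
    refine squeeze_zero (fun _ => dist_nonneg) (fun n => ?_) hlim0
    rw [dist_comm]
    exact hdist n y (hyS (n + 1))
  exact tendsto_nhds_unique h1 hz

theorem deform_aux {Z : Type*} [NormedAddCommGroup Z] [NormedSpace ℝ Z]
    {T : Type*} [MetricSpace T] [CompactSpace T]
    (E : Set Z) (hE : Convex ℝ E) (F : Z → ℝ) (F' : Z → Z →L[ℝ] ℝ)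
    (hF : ∀ z, HasFDerivAt F (F' z) z) (hF' : Continuous F')
    (γ : C(T, Z)) (hγ : ∀ t, γ t ∈ E) (A T₀ : Set T) (hA : IsClosed A) (hT₀ : IsClosed T₀)
    (hdisj : Disjoint T₀ A) (δ : ℝ) (hδ : 0 < δ)
    (hdec : ∀ t ∈ A, ∃ w ∈ E, F' (γ t) (w - γ t) < - (δ * ‖w - γ t‖)) (e : ℝ) (he : 0 < e) :
    ∃ s : ℝ, s > 0 ∧ ∃ η : C(T, Z), (∀ t, η t ∈ E) ∧ (∀ t ∈ T₀, η t = γ t) ∧ dist η γ ≤ s ∧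
      (∀ t ∈ A, F (η t) ≤ F (γ t) - δ * s) ∧ ∀ t, F (η t) ≤ F (γ t) + e := by
  -- continuous selection
  let S : T → Set (Z × ℝ) := fun t => {q | 0 < q.2 ∧ (∃ w ∈ E, q.1 = q.2 • w) ∧
    ‖q.1 - q.2 • γ t‖ < 1 ∧ (t ∈ A → F' (γ t) (q.1 - q.2 • γ t) < -δ)}
  have hSconv : ∀ t, Convex ℝ (S t) := by
    rintro t ⟨p, k⟩ ⟨hk, ⟨w, hw, hp⟩, hn, hd⟩ ⟨p', k'⟩ ⟨hk', ⟨w', hw', hp'⟩, hn', hd'⟩ a b ha hb hab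
    simp only at *
    have hkk : 0 < a * k + b * k' := by
      rcases eq_or_lt_of_le ha with h | h
      · have : b = 1 := by linarith
        subst h; subst this; simpa using hk'
      · nlinarith [mul_pos h hk, mul_nonneg hb hk'.le]
    have hsplit : (a • p + b • p') - (a * k + b * k') • γ t
        = a • (p - k • γ t) + b • (p' - k' • γ t) := by module
    refine ⟨by simpa using hkk, ?_, ?_, ?_⟩
    · refine ⟨(a * k / (a * k + b * k')) • w + (b * k' / (a * k + b * k')) • w',
        hE hw hw' (by positivity) (by positivity) (by field_simp), ?_⟩
      simp only [Prod.smul_mk, Prod.mk_add_mk, smul_eq_mul, smul_add, smul_smul, hp, hp']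
      congr 2 <;> field_simp
    · simp only [Prod.smul_mk, Prod.mk_add_mk, smul_eq_mul, hsplit]
      have := (convex_ball (0 : Z) 1) (x := p - k • γ t) (by simpa using hn)
        (y := p' - k' • γ t) (by simpa using hn') ha hb hab
      simpa using this
    · intro htA
      simp only [Prod.smul_mk, Prod.mk_add_mk, smul_eq_mul, hsplit, map_add, map_smul]
      have := (convex_Iio (-δ)) (hd htA) (hd' htA) ha hb hab
      simpa using this
  have hSloc : ∀ t, ∃ q : Z × ℝ, ∀ᶠ t' in 𝓝 t, q ∈ S t' := by
    intro t
    by_cases htA : t ∈ A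
    · obtain ⟨w, hw, hlt⟩ := hdec t htA
      have hpos : 0 < ‖w - γ t‖ := by
        rw [norm_pos_iff]; intro h; rw [h] at hlt; simp at hlt
      have hdpos : 0 < - F' (γ t) (w - γ t) := by nlinarith [mul_pos hδ hpos]
      obtain ⟨k, hk1, hk2⟩ : ∃ k, δ / (- F' (γ t) (w - γ t)) < k ∧ k < 1 / ‖w - γ t‖ := by
        apply exists_between
        rw [div_lt_div_iff₀ hdpos hpos]; linarith
      have hk : 0 < k := lt_trans (by positivity) hk1
      rw [div_lt_iff₀ hdpos] at hk1
      rw [lt_div_iff₀ hpos] at hk2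
      refine ⟨(k • w, k), ?_⟩
      have e1 : ∀ᶠ t' in 𝓝 t, ‖k • w - k • γ t'‖ < 1 := by
        have hc : Continuous fun t' => ‖k • w - k • γ t'‖ := by fun_prop
        refine hc.continuousAt.eventually_lt continuousAt_const ?_
        rw [← smul_sub, norm_smul, Real.norm_of_nonneg hk.le]; exact hk2
      have e2 : ∀ᶠ t' in 𝓝 t, F' (γ t') (k • w - k • γ t') < -δ := by
        have hc : Continuous fun t' => F' (γ t') (k • w - k • γ t') :=
          (hF'.comp γ.continuous).clm_apply (by fun_prop)
        refine hc.continuousAt.eventually_lt continuousAt_const ?_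
        rw [← smul_sub, map_smul, smul_eq_mul]; linarith
      filter_upwards [e1, e2] with t' h1 h2
      exact ⟨hk, ⟨w, hw, rfl⟩, h1, fun _ => h2⟩
    · refine ⟨(γ t, 1), ?_⟩
      have e1 : ∀ᶠ t' in 𝓝 t, ‖γ t - (1 : ℝ) • γ t'‖ < 1 := by
        have hc : Continuous fun t' => ‖γ t - (1 : ℝ) • γ t'‖ := by fun_prop
        refine hc.continuousAt.eventually_lt continuousAt_const ?_
        simp
      filter_upwards [e1, hA.isOpen_compl.mem_nhds htA] with t' h1 h2
      exact ⟨one_pos, ⟨γ t, hγ t, by simp⟩, h1, fun h => absurd h h2⟩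
  obtain ⟨g, hg⟩ := exists_continuous_forall_mem_convex_of_local_const hSconv hSloc
  obtain ⟨θ, hθ0, hθ1, hθ⟩ := exists_continuous_zero_one_of_isClosed hT₀ hA hdisj
  -- direction field
  let h : T → Z := fun t => θ t • ((g t).1 - (g t).2 • γ t)
  have hh : Continuous h := by fun_prop
  have hhn : ∀ t, ‖h t‖ ≤ 1 := by
    intro t
    simp only [h, norm_smul, Real.norm_of_nonneg (hθ t).1]
    exact mul_le_one₀ (hθ t).2 (norm_nonneg _) (hg t).2.2.1.le
  obtain ⟨K, hK⟩ : ∃ K, ∀ t, (g t).2 ≤ K := by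
    have hc : Continuous fun t => (g t).2 := by fun_prop
    obtain ⟨K, hK⟩ := (isCompact_range hc).bddAbove
    exact ⟨K, fun t => hK ⟨t, rfl⟩⟩
  have hcont1 : Continuous fun q : T × ℝ => F' (γ q.1 + q.2 • h q.1) (h q.1) :=
    (hF'.comp (by fun_prop)).clm_apply (by fun_prop)
  have hFc : Continuous F := continuous_iff_continuousAt.2 fun z => (hF z).continuousAt
  have hcont2 : Continuous fun q : T × ℝ => F (γ q.1 + q.2 • h q.1) - F (γ q.1) := by fun_prop
  obtain ⟨s₁, hs₁, H1⟩ : ∃ s₁ : ℝ, s₁ > 0 ∧ ∀ t ∈ A, ∀ s : ℝ, |s| < s₁ → F' (γ t + s • h t) (h t) < -δ := by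
    obtain ⟨u, v, hu, hv, hAu, h0v, huv⟩ := generalized_tube_lemma hA.isCompact
      (isCompact_singleton (x := (0 : ℝ))) (hcont1.isOpen_preimage _ (isOpen_Iio (a := -δ))) (by
        rintro ⟨t, s⟩ ⟨ht, hs⟩
        simp only [mem_singleton_iff] at hs
        have h1 := (hg t).2.2.2 ht
        have h2 : θ t = 1 := hθ1 ht
        simpa [h, hs, h2] using h1)
    obtain ⟨s₁, hs₁, hb⟩ := Metric.isOpen_iff.1 hv 0 (h0v rfl)
    refine ⟨s₁, hs₁, fun t ht s hs => ?_⟩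
    exact huv (mk_mem_prod (hAu ht) (hb (by simpa using hs)))
  obtain ⟨s₂, hs₂, H2⟩ : ∃ s₂ : ℝ, s₂ > 0 ∧ ∀ t : T, ∀ s : ℝ, |s| < s₂ →
      F (γ t + s • h t) - F (γ t) < e := by
    obtain ⟨u, v, hu, hv, hAu, h0v, huv⟩ := generalized_tube_lemma (isCompact_univ (X := T))
      (isCompact_singleton (x := (0 : ℝ))) (hcont2.isOpen_preimage _ (isOpen_Iio (a := e))) (by
        rintro ⟨t, s⟩ ⟨ht, hs⟩
        simp only [mem_singleton_iff] at hs
        simpa [hs] using he)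
    obtain ⟨s₁, hs₁, hb⟩ := Metric.isOpen_iff.1 hv 0 (h0v rfl)
    refine ⟨s₁, hs₁, fun t s hs => ?_⟩
    exact huv (mk_mem_prod (hAu (mem_univ t)) (hb (by simpa using hs)))
  obtain ⟨s, hs0, hs⟩ : ∃ s : ℝ, 0 < s ∧ s < min (min s₁ s₂) (1 / (|K| + 1)) :=
    exists_between (lt_min (lt_min hs₁ hs₂) (by positivity))
  have hss1 : s < s₁ := hs.trans_le ((min_le_left _ _).trans (min_le_left _ _))
  have hss2 : s < s₂ := hs.trans_le ((min_le_left _ _).trans (min_le_right _ _))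
  have hsK : s * (|K| + 1) < 1 := by
    have := hs.trans_le (min_le_right _ _)
    rwa [lt_div_iff₀ (by positivity)] at this
  refine ⟨s, hs0, ⟨fun t => γ t + s • h t, by fun_prop⟩, ?_, ?_, ?_, ?_, ?_⟩
  · intro t
    obtain ⟨hk, ⟨w, hw, hp⟩, -, -⟩ := hg t
    have h1 : s * θ t * (g t).2 ≤ 1 := by
      have : (g t).2 ≤ |K| + 1 := (hK t).trans (by linarith [le_abs_self K])
      have h3 : θ t * (g t).2 ≤ 1 * (|K| + 1) := mul_le_mul (hθ t).2 this hk.le zero_le_one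
      have := mul_le_mul_of_nonneg_left h3 hs0.le
      nlinarith
    have h0 : 0 ≤ s * θ t * (g t).2 := mul_nonneg (mul_nonneg hs0.le (hθ t).1) hk.le
    have : γ t + s • h t = (1 - s * θ t * (g t).2) • γ t + (s * θ t * (g t).2) • w := by
      simp only [h, hp]; module
    change γ t + s • h t ∈ E
    rw [this]
    exact hE (hγ t) hw (by linarith) h0 (by ring)
  · intro t ht
    have : θ t = 0 := hθ0 ht
    simp [h, this]
  · rw [ContinuousMap.dist_le hs0.le]
    intro t
    simp only [ContinuousMap.coe_mk, dist_eq_norm, add_sub_cancel_left, norm_smul,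
      Real.norm_of_nonneg hs0.le]
    nlinarith [hhn t]
  · intro t ht
    change F (γ t + s • h t) ≤ _
    have hder : ∀ σ : ℝ, HasDerivAt (fun σ : ℝ => F (γ t + σ • h t))
        (F' (γ t + σ • h t) (h t)) σ := by
      intro σ
      have h1 : HasDerivAt (fun σ : ℝ => γ t + σ • h t) (h t) σ := by
        simpa using ((hasDerivAt_id σ).smul_const (h t)).const_add (γ t)
      exact (hF _).comp_hasDerivAt σ h1
    obtain ⟨σ, hσ, hEq⟩ := exists_hasDerivAt_eq_slope (fun σ : ℝ => F (γ t + σ • h t)) _ hs0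
      (fun σ _ => (hder σ).continuousAt.continuousWithinAt) (fun σ _ => hder σ)
    have hlt := H1 t ht σ (by rw [abs_of_pos hσ.1]; linarith [hσ.2])
    rw [hEq, div_lt_iff₀ (by linarith)] at hlt
    simp only [zero_smul, add_zero, sub_zero] at hlt
    linarith
  · intro t
    have := H2 t s (by rwa [abs_of_pos hs0])
    change F (γ t + s • h t) ≤ _
    linarith

theorem minimax_aux {Z : Type*} [NormedAddCommGroup Z] [NormedSpace ℝ Z] [CompleteSpace Z]
    {T : Type*} [MetricSpace T] [CompactSpace T] [Nonempty T]
    (E : Set Z) (hE : Convex ℝ E) (hEc : IsClosed E) (F : Z → ℝ) (F' : Z → Z →L[ℝ] ℝ)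
    (hF : ∀ z, HasFDerivAt F (F' z) z) (hF' : Continuous F')
    (γ₀ : C(T, Z)) (hγ₀ : ∀ t, γ₀ t ∈ E) (c h k δ : ℝ) (hh : 0 < h) (hδ : 0 < δ)
    (hc : ∀ γ : C(T, Z), (∀ t, γ t ∈ E) → (∀ t, F (γ₀ t) ≤ c - h → γ t = γ₀ t) →
      ∃ t, c ≤ F (γ t)) (hk : ∀ t, F (γ₀ t) ≤ c + k) :
    ∃ z ∈ E, c - h ≤ F z ∧ F z ≤ c + k ∧
      (∃ t, c - h ≤ F (γ₀ t) ∧ dist z (γ₀ t) ≤ k / (δ / 2)) ∧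
      ∀ w ∈ E, - (δ * ‖w - z‖) ≤ F' z (w - z) := by
  have hFc : Continuous F := continuous_iff_continuousAt.2 fun z => (hF z).continuousAt
  let T₀ : Set T := {t | F (γ₀ t) ≤ c - h}
  have hT₀ : IsClosed T₀ := isClosed_le (by fun_prop) continuous_const
  let G : Set C(T, Z) := {γ | (∀ t, γ t ∈ E) ∧ ∀ t, F (γ₀ t) ≤ c - h → γ t = γ₀ t}
  have hG : IsClosed G := by
    have : G = (⋂ t, {γ : C(T, Z) | γ t ∈ E}) ∩
        ⋂ t, ⋂ (_ : F (γ₀ t) ≤ c - h), {γ : C(T, Z) | γ t = γ₀ t} := by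
      ext γ; simp [G]
    rw [this]
    refine (isClosed_iInter fun t => hEc.preimage (by fun_prop)).inter
      (isClosed_iInter fun t => isClosed_iInter fun _ => isClosed_eq (by fun_prop) (by fun_prop))
  have : CompleteSpace G := hG.completeSpace_coe
  let J : G → ℝ := fun γ => ⨆ t, F (γ.1 t)
  have hbdd : ∀ γ : C(T, Z), BddAbove (range fun t => F (γ t)) := fun γ =>
    (isCompact_range (by fun_prop)).bddAbove
  have hJ : LowerSemicontinuous J := by
    refine lowerSemicontinuous_ciSup (fun γ => hbdd γ.1) fun t => Continuous.lowerSemicontinuous ?_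
    exact hFc.comp (show Continuous fun γ : G => γ.1 t by fun_prop)
  have hJc : ∀ γ, c ≤ J γ := by
    intro γ
    obtain ⟨t, ht⟩ := hc γ.1 γ.2.1 γ.2.2
    exact ht.trans (le_ciSup (hbdd γ.1) t)
  let g₀ : G := ⟨γ₀, hγ₀, fun _ _ => rfl⟩
  obtain ⟨γ, hγ1, hγ2⟩ := ekeland_aux J hJ c hJc (δ / 2) (by positivity) g₀
  have hJ0 : J g₀ ≤ c + k := ciSup_le hk
  have hJle : ∀ t, F (γ.1 t) ≤ J γ := fun t => le_ciSup (hbdd γ.1) t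
  have hdist : dist γ.1 γ₀ ≤ k / (δ / 2) := by
    rw [le_div_iff₀ (by positivity)]
    have h1 : dist γ g₀ = dist γ.1 γ₀ := rfl
    have := hJc γ
    rw [h1] at hγ1
    linarith
  by_contra hcon
  push Not at hcon
  let A : Set T := {t | c - h / 2 ≤ F (γ.1 t)}
  have hA : IsClosed A := isClosed_le continuous_const (by fun_prop)
  have hdisj : Disjoint T₀ A := by
    rw [Set.disjoint_left]
    intro t ht htA
    have h1 : F (γ₀ t) ≤ c - h := ht
    have h2 : c - h / 2 ≤ F (γ.1 t) := htA
    rw [γ.2.2 t h1] at h2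
    linarith
  have hJγ : J γ ≤ c + k := by
    have : 0 ≤ δ / 2 * dist γ g₀ := by positivity
    linarith
  obtain ⟨s, hs, η, hη1, hη2, hη3, hη4, hη5⟩ := deform_aux E hE F F' hF hF' γ.1 γ.2.1 A T₀ hA hT₀
    hdisj δ hδ (by
      intro t ht
      have h2 : c - h / 2 ≤ F (γ.1 t) := ht
      have h3 : c - h ≤ F (γ₀ t) := by
        by_contra h4
        push Not at h4
        exact Set.disjoint_left.1 hdisj (show t ∈ T₀ from h4.le) ht
      exact hcon (γ.1 t) (γ.2.1 t) (by linarith) ((hJle t).trans hJγ)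
        ⟨t, h3, (ContinuousMap.dist_apply_le_dist t).trans hdist⟩) (h / 4) (by positivity)
  let η' : G := ⟨η, hη1, fun t ht => (hη2 t ht).trans (γ.2.2 t ht)⟩
  have hJη : J η' ≤ max (J γ - δ * s) (c - h / 4) := by
    refine ciSup_le fun t => ?_
    by_cases ht : t ∈ A
    · exact le_max_of_le_left ((hη4 t ht).trans (by linarith [hJle t]))
    · have h2 : F (γ.1 t) < c - h / 2 := not_le.1 ht
      exact le_max_of_le_right ((hη5 t).trans (by linarith))
  have hJη' : J η' ≤ J γ - δ * s := by
    rcases le_max_iff.1 hJη with h1 | h1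
    · exact h1
    · linarith [hJc η']
  have hd : dist η' γ ≤ s := hη3
  have hEq := hγ2 η' (by nlinarith)
  rw [hEq] at hJη'
  nlinarith

theorem ereal_real_of_le {a : EReal} {x : ℝ} (h0 : 0 ≤ a) (h : a ≤ (x : EReal)) :
    ∃ x' : ℝ, a = (x' : EReal) ∧ 0 ≤ x' ∧ x' ≤ x := by
  induction a with
  | bot => simp at h0
  | top => simp at h
  | coe r => exact ⟨r, rfl, by exact_mod_cast h0, by exact_mod_cast h⟩

theorem ILam_coe (Ψ : X → EReal) (Φ : X → ℝ) (lam : ℝ) (u : X) (x : ℝ) (h : Ψ u = (x : EReal)) :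
    ILam Ψ Φ lam u = ((lam * x - Φ u : ℝ) : EReal) := by
  rw [ILam, h]; push_cast; rfl

theorem ILam_real (Ψ : X → EReal) (Φ : X → ℝ) (lam : ℝ) (u : X) (m : ℝ) (hlam : 0 < lam)
    (h0 : 0 ≤ Ψ u) (h : ILam Ψ Φ lam u ≤ (m : EReal)) :
    ∃ x : ℝ, Ψ u = (x : EReal) ∧ 0 ≤ x ∧ lam * x - Φ u ≤ m := by
  rcases hΨ : Ψ u with _ | _ | x
  · rw [hΨ] at h0; exact absurd h0 (show ¬ (0 : EReal) ≤ ⊥ by simp)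
  · exfalso
    have h1 : ILam Ψ Φ lam u = ⊤ := by
      rw [ILam, hΨ]
      change (lam : EReal) * ⊤ - _ = ⊤
      rw [EReal.coe_mul_top_of_pos hlam, EReal.top_sub_coe]
    rw [h1] at h
    simp at h
  · have hΨ' : Ψ u = (x : EReal) := hΨ
    rw [ILam_coe Ψ Φ lam u x hΨ'] at h
    rw [hΨ'] at h0
    exact ⟨x, rfl, by exact_mod_cast h0, by exact_mod_cast h⟩

theorem isCrit_of_real (Ψ : X → EReal) (Φ : X → ℝ) (lam : ℝ) (hlam : 0 < lam)
    (hΨnn : ∀ u : X, 0 ≤ Ψ u) (u : X) (x : ℝ)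
    (hx : Ψ u = (x : EReal))
    (h : ∀ (v : X) (y : ℝ), Ψ v ≤ (y : EReal) → 0 ≤ lam * (y - x) - fderiv ℝ Φ u (v - u)) :
    IsCriticalPoint Ψ Φ lam u := by
  intro v
  have h0 := hΨnn v
  rw [hx]
  rcases hΨ : Ψ v with _ | _ | y
  · rw [hΨ] at h0; exact absurd h0 (show ¬ (0 : EReal) ≤ ⊥ by simp)
  · change 0 ≤ (lam : EReal) * (⊤ - _) - _
    rw [EReal.top_sub_coe, EReal.coe_mul_top_of_pos hlam, EReal.top_sub_coe]
    simp
  · have := h v y hΨ.le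
    change 0 ≤ (lam : EReal) * ((y : EReal) - _) - _
    exact_mod_cast this

def epiSet (Ψ : X → EReal) : Set (X × ℝ) := {q | Ψ q.1 ≤ (q.2 : EReal)}

theorem epiSet_closed (Ψ : X → EReal) (hΨlsc : LowerSemicontinuous Ψ) :
    IsClosed (epiSet Ψ) := by
  have h := hΨlsc.isClosed_epigraph
  exact h.preimage (f := fun q : X × ℝ => (q.1, (q.2 : EReal)))
    (continuous_fst.prodMk (continuous_coe_real_ereal.comp continuous_snd))

theorem epiSet_convex (Ψ : X → EReal) (hΨnn : ∀ u : X, 0 ≤ Ψ u)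
    (hΨconv : ∀ u v : X, ∀ a b : ℝ, 0 ≤ a → 0 ≤ b → a + b = 1 →
      Ψ (a • u + b • v) ≤ (a : EReal) * Ψ u + (b : EReal) * Ψ v) :
    Convex ℝ (epiSet Ψ) := by
  rintro ⟨u, x⟩ hu ⟨v, y⟩ hv a b ha hb hab
  obtain ⟨x', hx', -, hxx⟩ := ereal_real_of_le (hΨnn u) hu
  obtain ⟨y', hy', -, hyy⟩ := ereal_real_of_le (hΨnn v) hv
  have h := hΨconv u v a b ha hb hab
  rw [hx', hy'] at h
  refine h.trans ?_
  simp only at hxx hyy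
  have : a * x' + b * y' ≤ a * x + b * y := by gcongr
  change _ ≤ ((a * x + b * y : ℝ) : EReal)
  exact_mod_cast this

theorem limit_aux (Ψ : X → EReal) (Φ : X → ℝ)
    (hΨ0 : Ψ 0 = 0) (hΨnn : ∀ u : X, 0 ≤ Ψ u)
    (hEc : IsClosed (epiSet Ψ)) (hE : Convex ℝ (epiSet Ψ))
    (hΨ3 : ∀ (u : ℕ → X) (w : X), (∀ j, Ψ (u j) ≠ ⊤) → Ψ w ≠ ⊤ →
      (∀ f : X →L[ℝ] ℝ, Tendsto (fun j => f (u j)) atTop (𝓝 (f w))) →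
      Tendsto (fun j => Ψ (u j)) atTop (𝓝 (Ψ w)) →
      Tendsto (fun j => ‖u j - w‖) atTop (𝓝 0))
    (hΦ : ContDiff ℝ 1 Φ)
    (hΦ2 : ∀ u : ℕ → X, IsBounded (range u) →
      ∃ (φ : ℕ → ℕ) (w : X), StrictMono φ ∧
        (∀ f : X →L[ℝ] ℝ, Tendsto (fun j => f (u (φ j))) atTop (𝓝 (f w))) ∧
        ∀ v : X, ((fderiv ℝ Φ w (v - w) : ℝ) : EReal) ≤
          Filter.liminf
            (fun j => ((fderiv ℝ Φ (u (φ j)) (v - u (φ j)) : ℝ) : EReal)) atTop)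
    (lam : ℝ) (hlam : 0 < lam) (c : ℝ) (l δ : ℕ → ℝ) (u : ℕ → X) (x : ℕ → ℝ)
    (hl : Tendsto l atTop (𝓝 lam)) (hδ : Tendsto δ atTop (𝓝 0)) (hδ0 : ∀ j, 0 ≤ δ j)
    (hx : ∀ j, Ψ (u j) = (x j : EReal)) (hu : IsBounded (range u))
    (hc : Tendsto (fun j => l j * x j - Φ (u j)) atTop (𝓝 c))
    (hcrit : ∀ j (v : X) (y : ℝ), Ψ v ≤ (y : EReal) →
      -(δ j * (‖v - u j‖ + |y - x j|)) ≤ l j * (y - x j) - fderiv ℝ Φ (u j) (v - u j)) :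
    ∃ (w : X) (z : ℝ), Ψ w = (z : EReal) ∧ lam * z - Φ w = c ∧
      ∀ (v : X) (y : ℝ), Ψ v ≤ (y : EReal) → 0 ≤ lam * (y - z) - fderiv ℝ Φ w (v - w) := by
  obtain ⟨φ, w, hφ, hweak, hlim⟩ := hΦ2 u hu
  obtain ⟨B, hB⟩ := hu.exists_norm_le
  have hB' : ∀ j, ‖u j‖ ≤ B := fun j => hB _ ⟨j, rfl⟩
  have hB0 : 0 ≤ B := (norm_nonneg _).trans (hB' 0)
  have hx0 : ∀ j, 0 ≤ x j := fun j => by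
    have := hΨnn (u j); rw [hx j] at this; exact_mod_cast this
  have hev : ∀ v (r : ℝ), r < fderiv ℝ Φ w (v - w) →
      ∀ᶠ j in atTop, r < fderiv ℝ Φ (u (φ j)) (v - u (φ j)) := by
    intro v r hr
    have h1 : (r : EReal) < Filter.liminf
            (fun j => ((fderiv ℝ Φ (u (φ j)) (v - u (φ j)) : ℝ) : EReal)) atTop :=
      lt_of_lt_of_le (by exact_mod_cast hr) (hlim v)
    filter_upwards [eventually_lt_of_lt_liminf h1] with j hj
    exact_mod_cast hj
  have hlφ := hl.comp hφ.tendsto_atTop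
  have hδφ := hδ.comp hφ.tendsto_atTop
  set m := fderiv ℝ Φ w (0 - w) with hm
  have hxb : ∀ᶠ j in atTop, x (φ j) ∈ Icc 0 ((lam / 4 * B + |m| + 1) / (lam / 4)) := by
    filter_upwards [hev 0 (m - 1) (by linarith),
      hlφ.eventually_const_lt (show lam / 2 < lam by linarith),
      hδφ.eventually_lt_const (show 0 < lam / 4 by linarith)] with j h1 h2 h3
    refine ⟨hx0 _, ?_⟩
    simp only [Function.comp] at h2 h3
    have h4 := hcrit (φ j) 0 0 (by rw [hΨ0]; simp)
    rw [zero_sub, norm_neg, zero_sub, abs_neg, abs_of_nonneg (hx0 _)] at h4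
    rw [zero_sub] at h1
    rw [le_div_iff₀ (by positivity)]
    have h5 := hδ0 (φ j)
    have h6 := hB' (φ j)
    have h7 := hx0 (φ j)
    have h8 := neg_abs_le m
    have h9 : δ (φ j) * ‖u (φ j)‖ ≤ lam / 4 * B := by gcongr
    have h10 : δ (φ j) * x (φ j) ≤ lam / 4 * x (φ j) := by gcongr
    have h11 : lam / 2 * x (φ j) ≤ l (φ j) * x (φ j) := by gcongr
    linarith
  obtain ⟨z, hz, ψ, hψ, hxz⟩ := isCompact_Icc.tendsto_subseq' hxb.frequently
  set θ := φ ∘ ψ with hθ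
  have hθm : StrictMono θ := hφ.comp hψ
  have hxz' : Tendsto (fun j => x (θ j)) atTop (𝓝 z) := hxz
  have hweak' : ∀ f : X →L[ℝ] ℝ, Tendsto (fun j => f (u (θ j))) atTop (𝓝 (f w)) :=
    fun f => (hweak f).comp hψ.tendsto_atTop
  have hlθ : Tendsto (fun j => l (θ j)) atTop (𝓝 lam) := hl.comp hθm.tendsto_atTop
  have hδθ : Tendsto (fun j => δ (θ j)) atTop (𝓝 0) := hδ.comp hθm.tendsto_atTop
  have hwz : (w, z) ∈ epiSet Ψ := by
    by_contra hnot
    obtain ⟨f, a, h1, h2⟩ := geometric_hahn_banach_closed_point hE hEc hnot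
    have h3 : Tendsto (fun j => f (u (θ j), x (θ j))) atTop (𝓝 (f (w, z))) := by
      have e : ∀ (a : X) (b : ℝ), f (a, b) = (f.comp (ContinuousLinearMap.inl ℝ X ℝ)) a
          + (f.comp (ContinuousLinearMap.inr ℝ X ℝ)) b := by
        intro a b
        simp [← map_add]
      simp only [e]
      exact (hweak' _).add (((ContinuousLinearMap.continuous _).tendsto z).comp hxz')
    have h4 : f (w, z) ≤ a := le_of_tendsto' h3 fun j => (h1 _ (hx (θ j)).le).le
    linarith
  have hcritw : ∀ (v : X) (y : ℝ), Ψ v ≤ (y : EReal) →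
      fderiv ℝ Φ w (v - w) ≤ lam * (y - z) := by
    intro v y hv
    refine le_of_forall_lt_imp_le_of_dense fun r hr => ?_
    have hev' := hψ.tendsto_atTop.eventually (hev v r hr)
    have t1 : Tendsto (fun j => δ (θ j) * ((‖v‖ + B) + |y - x (θ j)|)) atTop
        (𝓝 (0 * ((‖v‖ + B) + |y - z|))) :=
      hδθ.mul ((hxz'.const_sub y).abs.const_add _)
    have t2 : Tendsto (fun j => l (θ j) * (y - x (θ j)) +
        δ (θ j) * ((‖v‖ + B) + |y - x (θ j)|)) atTop
        (𝓝 (lam * (y - z) + 0 * ((‖v‖ + B) + |y - z|))) :=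
      (hlθ.mul (hxz'.const_sub y)).add t1
    rw [zero_mul, add_zero] at t2
    refine ge_of_tendsto t2 ?_
    filter_upwards [hev'] with j hj
    have h1 := hcrit (θ j) v y hv
    have h2 : ‖v - u (θ j)‖ ≤ ‖v‖ + B := (norm_sub_le _ _).trans (by linarith [hB' (θ j)])
    have h3 : δ (θ j) * (‖v - u (θ j)‖ + |y - x (θ j)|) ≤
        δ (θ j) * ((‖v‖ + B) + |y - x (θ j)|) := by
      have := hδ0 (θ j)
      gcongr
    have h4 : r < fderiv ℝ Φ (u (θ j)) (v - u (θ j)) := hj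
    linarith
  obtain ⟨z', hz', -, hzz⟩ := ereal_real_of_le (hΨnn w) hwz
  have hzeq : z' = z := by
    have h1 := hcritw w z' hz'.le
    rw [sub_self, map_zero] at h1
    simp only at hzz
    nlinarith
  subst hzeq
  have hstrong := hΨ3 (fun j => u (θ j)) w (fun j => by rw [hx]; simp) (by rw [hz']; simp) hweak'
    (by simp only [hx, hz']; exact (continuous_coe_real_ereal.tendsto z').comp hxz')
  have hstr : Tendsto (fun j => u (θ j)) atTop (𝓝 w) := tendsto_iff_norm_sub_tendsto_zero.2 hstrong
  refine ⟨w, z', hz', ?_, fun v y hv => by linarith [hcritw v y hv]⟩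
  have h1 : Tendsto (fun j => l (θ j) * x (θ j) - Φ (u (θ j))) atTop (𝓝 (lam * z' - Φ w)) :=
    (hlθ.mul hxz').sub ((hΦ.continuous.tendsto w).comp hstr)
  exact tendsto_nhds_unique h1 (hc.comp hθm.tendsto_atTop)

/-- Paths in the epigraph. -/
def EPath (Ψ : X → EReal) (u₀ : X) (x₀ : ℝ) (γ : C(unitInterval, X × ℝ)) : Prop :=
  (∀ t, γ t ∈ epiSet Ψ) ∧ γ 0 = (0, 0) ∧ γ 1 = (u₀, x₀)

def cSet (Ψ : X → EReal) (Φ : X → ℝ) (u₀ : X) (x₀ lam : ℝ) : Set ℝ :=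
  {m | ∃ γ, EPath Ψ u₀ x₀ γ ∧ ∀ t, lam * (γ t).2 - Φ (γ t).1 ≤ m}

def cE (Ψ : X → EReal) (Φ : X → ℝ) (u₀ : X) (x₀ lam : ℝ) : ℝ := sInf (cSet Ψ Φ u₀ x₀ lam)

theorem epi_nonneg (Ψ : X → EReal) (hΨnn : ∀ u : X, 0 ≤ Ψ u) {q : X × ℝ} (hq : q ∈ epiSet Ψ) :
    0 ≤ q.2 := by
  have : (0 : EReal) ≤ (q.2 : EReal) := (hΨnn q.1).trans hq
  exact_mod_cast this

theorem epath_cross (Ψ : X → EReal) (Φ : X → ℝ) (hΨnn : ∀ u : X, 0 ≤ Ψ u)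
    (u₀ : X) (x₀ ρ₀ α₀ : ℝ) (hρ₀ : 0 < ρ₀) (hu₀ : ρ₀ < ‖u₀‖)
    (hsph : ∀ (u : X) (x : ℝ), ‖u‖ = ρ₀ → Ψ u ≤ (x : EReal) → α₀ ≤ x - Φ u)
    (lam : ℝ) (hlam : 1 ≤ lam) (γ : C(unitInterval, X × ℝ)) (hγ : EPath Ψ u₀ x₀ γ) :
    ∃ t, α₀ ≤ lam * (γ t).2 - Φ (γ t).1 := by
  have hc : Continuous fun t => ‖(γ t).1‖ := by fun_prop
  obtain ⟨t, ht⟩ := mem_range_of_exists_le_of_exists_ge hc (c := ρ₀)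
    ⟨0, by rw [hγ.2.1]; simpa using hρ₀.le⟩ ⟨1, by rw [hγ.2.2]; exact hu₀.le⟩
  refine ⟨t, (hsph _ _ ht (hγ.1 t)).trans ?_⟩
  have := epi_nonneg Ψ hΨnn (hγ.1 t)
  nlinarith

theorem cSet_nonempty (Ψ : X → EReal) (Φ : X → ℝ) (hΦ : Continuous Φ)
    (hE : Convex ℝ (epiSet Ψ)) (hΨ0 : Ψ 0 = 0)
    (u₀ : X) (x₀ : ℝ) (hx₀ : Ψ u₀ = (x₀ : EReal)) (lam : ℝ) :
    (cSet Ψ Φ u₀ x₀ lam).Nonempty := by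
  let γ : C(unitInterval, X × ℝ) := ⟨fun t => ((t : ℝ) • u₀, (t : ℝ) • x₀), by fun_prop⟩
  have hc : Continuous fun t => lam * (γ t).2 - Φ (γ t).1 := by fun_prop
  obtain ⟨m, hm⟩ := (isCompact_range hc).bddAbove
  refine ⟨m, γ, ⟨fun t => ?_, by simp [γ], by simp [γ]⟩, fun t => hm ⟨t, rfl⟩⟩
  have h0 : ((0 : X), (0 : ℝ)) ∈ epiSet Ψ := by simp [epiSet, hΨ0]
  have h1 : (u₀, x₀) ∈ epiSet Ψ := hx₀.le
  have := hE h0 h1 (a := 1 - (t : ℝ)) (b := t) (by linarith [t.2.2]) t.2.1 (by ring)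
  simpa [γ] using this

theorem mp_cSet_eq (Ψ : X → EReal) (Φ : X → ℝ) (hΦ : Continuous Φ) (hΨnn : ∀ u : X, 0 ≤ Ψ u)
    (hΨ0 : Ψ 0 = 0) (u₀ : X) (x₀ : ℝ) (hx₀ : Ψ u₀ = (x₀ : EReal)) :
    mpValue Ψ Φ u₀ 1 = cE Ψ Φ u₀ x₀ 1 := by
  unfold mpValue cE
  congr 1
  ext m
  constructor
  · rintro ⟨γ, ⟨hγc, hγ0, hγ1⟩, hm⟩
    have hle : ∀ t ∈ Icc (0 : ℝ) 1, Ψ (γ t) ≤ ((m + Φ (γ t) : ℝ) : EReal) := by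
      intro t ht
      obtain ⟨x, hx, -, h⟩ := ILam_real Ψ Φ 1 _ m one_pos (hΨnn _) (hm t ht)
      rw [hx]
      exact_mod_cast (by linarith : x ≤ m + Φ (γ t))
    have hh0 : 0 ≤ m + Φ 0 := by
      have := hle 0 (by simp)
      rw [hγ0, hΨ0] at this
      exact_mod_cast this
    have hh1 : x₀ ≤ m + Φ u₀ := by
      have := hle 1 (by simp)
      rw [hγ1, hx₀] at this
      exact_mod_cast this
    let p : unitInterval → ℝ := fun t => max 0 (min 1 (3 * (t : ℝ) - 1))
    have hp : ∀ t, p t ∈ Icc (0 : ℝ) 1 := fun t =>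
      ⟨le_max_left _ _, max_le zero_le_one (min_le_left _ _)⟩
    have hpc : Continuous p := by fun_prop
    have hγp : Continuous fun t => γ (p t) := hγc.comp_continuous hpc hp
    let ξ : unitInterval → ℝ := fun t => m + Φ (γ (p t)) - (m + Φ 0) * max 0 (1 - 3 * (t : ℝ))
      - (m + Φ u₀ - x₀) * max 0 (3 * (t : ℝ) - 2)
    have hξ : Continuous ξ := by
      have h1 : Continuous fun t => Φ (γ (p t)) := hΦ.comp hγp
      change Continuous fun t : unitInterval => m + Φ (γ (p t))
        - (m + Φ 0) * max 0 (1 - 3 * (t : ℝ)) - (m + Φ u₀ - x₀) * max 0 (3 * (t : ℝ) - 2)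
      exact ((continuous_const.add h1).sub (by fun_prop)).sub (by fun_prop)
    refine ⟨⟨fun t => (γ (p t), ξ t), hγp.prodMk hξ⟩, ⟨fun t => ?_, ?_, ?_⟩, fun t => ?_⟩
    · change Ψ (γ (p t)) ≤ (ξ t : EReal)
      rcases le_total (3 * (t : ℝ)) 1 with h | h
      · have hp0 : p t = 0 := by
          simp only [p]; rw [max_eq_left]; exact (min_le_right _ _).trans (by linarith)
        rw [hp0, hγ0, hΨ0]
        have : 0 ≤ ξ t := by
          simp only [ξ]
          rw [hp0, hγ0, max_eq_right (by linarith), max_eq_left (by linarith)]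
          have := mul_nonneg hh0 (mul_nonneg zero_le_three t.2.1)
          nlinarith
        exact_mod_cast this
      · rcases le_total (3 * (t : ℝ)) 2 with h' | h'
        · have : ξ t = m + Φ (γ (p t)) := by
            simp only [ξ]
            rw [max_eq_left (by linarith), max_eq_left (by linarith)]; ring
          rw [this]
          exact hle _ (hp t)
        · have hp0 : p t = 1 := by
            simp only [p]; rw [min_eq_left (by linarith)]; simp
          rw [hp0, hγ1, hx₀]
          have : x₀ ≤ ξ t := by
            simp only [ξ]
            rw [hp0, hγ1, max_eq_left (by linarith), max_eq_right (by linarith)]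
            have := mul_nonneg (sub_nonneg.2 hh1) (mul_nonneg zero_le_three (sub_nonneg.2 t.2.2))
            nlinarith
          exact_mod_cast this
    · have hp0 : p 0 = 0 := by simp [p]
      simp [ξ, hp0, hγ0]
    · have hp0 : p 1 = 1 := by simp [p]; norm_num
      simp [ξ, hp0, hγ1]; norm_num
    · simp only [ContinuousMap.coe_mk, ξ]
      have h1 := mul_nonneg hh0 (le_max_left 0 (1 - 3 * (t : ℝ)))
      have h2 := mul_nonneg (sub_nonneg.2 hh1) (le_max_left 0 (3 * (t : ℝ) - 2))
      linarith
  · rintro ⟨γ, ⟨hγE, hγ0, hγ1⟩, hm⟩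
    refine ⟨fun t => (γ (projIcc 0 1 zero_le_one t)).1, ⟨?_, ?_, ?_⟩, ?_⟩
    · have : Continuous fun t : ℝ => (γ (projIcc 0 1 zero_le_one t)).1 :=
        continuous_fst.comp (γ.continuous.comp continuous_projIcc)
      exact this.continuousOn
    · change (γ (projIcc 0 1 zero_le_one 0)).1 = 0
      rw [projIcc_left]
      exact congrArg Prod.fst hγ0
    · change (γ (projIcc 0 1 zero_le_one 1)).1 = u₀
      rw [projIcc_right]
      exact congrArg Prod.fst hγ1
    · intro t ht
      obtain ⟨x, hx, -, hxx⟩ := ereal_real_of_le (hΨnn _) (hγE (projIcc 0 1 zero_le_one t))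
      rw [ILam_coe Ψ Φ 1 _ x hx]
      have := hm (projIcc 0 1 zero_le_one t)
      exact_mod_cast (by linarith :
        1 * x - Φ (γ (projIcc 0 1 zero_le_one t)).1 ≤ m)

theorem ps_aux [CompleteSpace X] (Ψ : X → EReal) (Φ : X → ℝ) (hΨnn : ∀ u : X, 0 ≤ Ψ u)
    (hEc : IsClosed (epiSet Ψ)) (hE : Convex ℝ (epiSet Ψ)) (hΦ : ContDiff ℝ 1 Φ)
    (u₀ : X) (x₀ α₀ R D lam : ℝ) (hα₀ : 0 < α₀) (hlam : 1 ≤ lam) (hD : 0 ≤ D)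
    (hne : ∀ μ, (cSet Ψ Φ u₀ x₀ μ).Nonempty)
    (hbd : ∀ m ∈ cSet Ψ Φ u₀ x₀ lam, α₀ ≤ m)
    (hR : ∀ u : X, Ψ u ≤ ((D + 2 : ℝ) : EReal) → ‖u‖ ≤ R)
    (h0 : - Φ 0 ≤ 0) (h1 : lam * x₀ - Φ u₀ ≤ 0)
    (hquot : ∀ τ > 0, ∃ μ, lam < μ ∧ μ < lam + τ ∧
      cE Ψ Φ u₀ x₀ μ ≤ cE Ψ Φ u₀ x₀ lam + D * (μ - lam))
    (δ : ℝ) (hδ : 0 < δ) (hδ1 : δ < 1) :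
    ∃ (u : X) (x : ℝ), Ψ u = (x : EReal) ∧ ‖u‖ ≤ R + 1 ∧
      |lam * x - Φ u - cE Ψ Φ u₀ x₀ lam| ≤ δ ∧
      ∀ (v : X) (y : ℝ), Ψ v ≤ (y : EReal) →
      -(δ * (‖v - u‖ + |y - x|)) ≤ lam * (y - x) - fderiv ℝ Φ u (v - u) := by
  set c := cE Ψ Φ u₀ x₀ lam with hc
  have hbb : BddBelow (cSet Ψ Φ u₀ x₀ lam) := ⟨α₀, hbd⟩
  have hcα : α₀ ≤ c := le_csInf (hne lam) hbd
  obtain ⟨μ, hμ1, hμ2, hμ3⟩ := hquot (min (δ / 2 / (D + 1)) α₀) (by positivity)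
  set h := μ - lam with hh
  have hhpos : 0 < h := by linarith
  have hhα : h ≤ α₀ := by
    have := min_le_right (δ / 2 / (D + 1)) α₀
    linarith
  have hhD : (D + 1) * h ≤ δ / 2 := by
    have h2 := min_le_left (δ / 2 / (D + 1)) α₀
    have h3 : h ≤ δ / 2 / (D + 1) := by linarith
    rw [le_div_iff₀ (by positivity)] at h3
    linarith
  obtain ⟨m, ⟨γ₀, hγ₀, hm⟩, hmlt⟩ := exists_lt_of_csInf_lt (hne μ)
    (lt_add_of_pos_right (cE Ψ Φ u₀ x₀ μ) hhpos)
  have hmle : m ≤ c + (D + 1) * h := by linarith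
  let F : X × ℝ → ℝ := fun q => lam * q.2 - Φ q.1
  let F' : X × ℝ → (X × ℝ →L[ℝ] ℝ) := fun q =>
    lam • ContinuousLinearMap.snd ℝ X ℝ - (fderiv ℝ Φ q.1).comp (ContinuousLinearMap.fst ℝ X ℝ)
  have hF : ∀ q, HasFDerivAt F (F' q) q := by
    intro q
    have e1 : HasFDerivAt (fun q : X × ℝ => q.2) (ContinuousLinearMap.snd ℝ X ℝ) q :=
      hasFDerivAt_snd
    have e2 : HasFDerivAt (fun q : X × ℝ => q.1) (ContinuousLinearMap.fst ℝ X ℝ) q :=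
      hasFDerivAt_fst
    have e3 : HasFDerivAt Φ (fderiv ℝ Φ q.1) q.1 :=
      ((hΦ.differentiable (by norm_num)) q.1).hasFDerivAt
    exact (e1.const_mul lam).sub (e3.comp q e2)
  have hfd : Continuous (fderiv ℝ Φ) := hΦ.continuous_fderiv (by norm_num)
  have hF' : Continuous F' :=
    continuous_const.sub ((hfd.comp continuous_fst).clm_comp continuous_const)
  have hFle : ∀ t, F (γ₀ t) + h * (γ₀ t).2 ≤ m := by
    intro t
    have := hm t
    simp only [F, hh]
    linarith
  have hpos : ∀ t, 0 ≤ (γ₀ t).2 := fun t => epi_nonneg Ψ hΨnn (hγ₀.1 t)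
  obtain ⟨⟨u, x⟩, hz, hz1, hz2, ⟨t, ht1, ht2⟩, hz3⟩ := minimax_aux (epiSet Ψ) hE hEc F F' hF hF' γ₀ hγ₀.1 c h
    ((D + 1) * h) δ hhpos hδ (by
      intro γ hγE hγeq
      have g0 : γ 0 = (0, 0) := by
        rw [← hγ₀.2.1]
        apply hγeq
        rw [hγ₀.2.1]
        simp only [F]
        linarith
      have g1 : γ 1 = (u₀, x₀) := by
        rw [← hγ₀.2.2]
        apply hγeq
        rw [hγ₀.2.2]
        simp only [F]
        linarith
      have hcont : Continuous fun t => lam * (γ t).2 - Φ (γ t).1 := by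
        have := hΦ.continuous
        fun_prop
      obtain ⟨t, -, ht⟩ := isCompact_univ.exists_isMaxOn univ_nonempty hcont.continuousOn
      exact ⟨t, csInf_le hbb ⟨γ, ⟨hγE, g0, g1⟩, fun t' => ht (mem_univ t')⟩⟩) (by
      intro t
      have := hFle t
      have := mul_nonneg hhpos.le (hpos t)
      linarith)
  have hcr : ∀ (v : X) (y : ℝ), Ψ v ≤ (y : EReal) →
      -(δ * (‖v - u‖ + |y - x|)) ≤ lam * (y - x) - fderiv ℝ Φ u (v - u) := by
    intro v y hv
    have e1 := hz3 (v, y) hv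
    have e2 : F' (u, x) ((v, y) - (u, x)) = lam * (y - x) - fderiv ℝ Φ u (v - u) := by
      simp [F']
    have e3 : ‖(v, y) - (u, x)‖ ≤ ‖v - u‖ + |y - x| := by
      rw [Prod.mk_sub_mk, Prod.norm_mk, Real.norm_eq_abs]
      exact max_le_add_of_nonneg (norm_nonneg _) (abs_nonneg _)
    rw [e2] at e1
    have := mul_le_mul_of_nonneg_left e3 hδ.le
    linarith
  obtain ⟨x', hx', -, hxx⟩ := ereal_real_of_le (hΨnn u) hz
  have hxeq : x' = x := by
    have := hcr u x' hx'.le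
    simp only at hxx
    rw [sub_self, norm_zero, map_zero, abs_of_nonpos (by linarith)] at this
    nlinarith
  subst hxeq
  refine ⟨u, x', hx', ?_, ?_, hcr⟩
  · have e1 : h * (γ₀ t).2 ≤ h * (D + 2) := by linarith [hFle t]
    have e2 : (γ₀ t).2 ≤ D + 2 := le_of_mul_le_mul_left e1 hhpos
    have e3 : ‖(γ₀ t).1‖ ≤ R := by
      apply hR
      refine le_trans (hγ₀.1 t) ?_
      exact_mod_cast e2
    have e4 : (D + 1) * h / (δ / 2) ≤ 1 := by
      rw [div_le_one (by positivity)]; exact hhD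
    have e5 : dist u (γ₀ t).1 ≤ 1 := (le_max_left _ _).trans (ht2.trans e4)
    rw [dist_eq_norm] at e5
    have := norm_le_norm_add_norm_sub' u (γ₀ t).1
    linarith
  · simp only [F] at hz1 hz2
    rw [abs_le]
    constructor <;> nlinarith

theorem mountain_pass_theorem
    [CompleteSpace X]
    (Ψ : X → EReal) (Φ : X → ℝ)
    -- (Ψ1)
    (hΨ0 : Ψ 0 = 0)
    (hΨnn : ∀ u : X, 0 ≤ Ψ u)
    (hΨlsc : LowerSemicontinuous Ψ)
    (hΨconv : ∀ u v : X, ∀ a b : ℝ, 0 ≤ a → 0 ≤ b → a + b = 1 →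
      Ψ (a • u + b • v) ≤ (a : EReal) * Ψ u + (b : EReal) * Ψ v)
    -- (Ψ2): Ψ(u) → ∞ as ‖u‖ → ∞
    (hΨcoer : ∀ C : ℝ, ∃ R : ℝ, ∀ u : X, R ≤ ‖u‖ → (C : EReal) ≤ Ψ u)
    -- (Ψ3)
    (hΨ3 : ∀ (u : ℕ → X) (w : X), (∀ j, Ψ (u j) ≠ ⊤) → Ψ w ≠ ⊤ →
      (∀ f : X →L[ℝ] ℝ, Tendsto (fun j => f (u j)) atTop (𝓝 (f w))) →
      Tendsto (fun j => Ψ (u j)) atTop (𝓝 (Ψ w)) →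
      Tendsto (fun j => ‖u j - w‖) atTop (𝓝 0))
    -- (Φ1)
    (hΦ : ContDiff ℝ 1 Φ)
    -- (Φ2)
    (hΦ2 : ∀ u : ℕ → X, IsBounded (range u) →
      ∃ (φ : ℕ → ℕ) (w : X), StrictMono φ ∧
        (∀ f : X →L[ℝ] ℝ, Tendsto (fun j => f (u (φ j))) atTop (𝓝 (f w))) ∧
        ∀ v : X, ((fderiv ℝ Φ w (v - w) : ℝ) : EReal) ≤
          Filter.liminf
            (fun j => ((fderiv ℝ Φ (u (φ j)) (v - u (φ j)) : ℝ) : EReal)) atTop)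
    -- (IB)
    (hIB : ∀ a b c : ℝ, 0 < a → a ≤ b →
      IsBounded {u : X | ∃ lam ∈ Icc a b,
        IsCriticalPoint Ψ Φ lam u ∧ ILam Ψ Φ lam u ≤ (c : EReal)})
    -- (MP)
    (ρ₀ α₀ ε : ℝ) (u₀ : X)
    (hρ₀ : 0 < ρ₀) (hα₀ : 0 < α₀) (hε : 0 < ε)
    (hinf : (⨅ u ∈ {u : X | ‖u‖ = ρ₀}, ILam Ψ Φ (1 - ε) u) = (α₀ : EReal))
    (hu₀ : ρ₀ < ‖u₀‖)
    (hI0 : ILam Ψ Φ (1 + ε) 0 ≤ 0)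
    (hIu₀ : ILam Ψ Φ (1 + ε) u₀ ≤ 0) :
    ∃ u : X, IsCriticalPoint Ψ Φ 1 u ∧
      ILam Ψ Φ 1 u = ((mpValue Ψ Φ u₀ 1 : ℝ) : EReal) := by
  have hE := epiSet_convex Ψ hΨnn hΨconv
  have hEc := epiSet_closed Ψ hΨlsc
  obtain ⟨x₀, hx₀, hx₀0, hx₀le⟩ := ILam_real Ψ Φ (1 + ε) u₀ 0 (by linarith) (hΨnn _)
    (by simpa using hIu₀)
  have hΦ0 : - Φ 0 ≤ 0 := by
    rw [ILam_coe Ψ Φ (1 + ε) 0 0 (by simpa using hΨ0)] at hI0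
    have : (1 + ε) * 0 - Φ 0 ≤ 0 := by exact_mod_cast hI0
    linarith
  have hsph : ∀ (u : X) (x : ℝ), ‖u‖ = ρ₀ → Ψ u ≤ (x : EReal) → α₀ ≤ x - Φ u := by
    intro u x hu hux
    obtain ⟨x', hx', hx0, hxx⟩ := ereal_real_of_le (hΨnn u) hux
    have h1 : (α₀ : EReal) ≤ ILam Ψ Φ (1 - ε) u := by
      rw [← hinf]
      exact iInf₂_le u hu
    rw [ILam_coe Ψ Φ (1 - ε) u x' hx'] at h1
    have h2 : α₀ ≤ (1 - ε) * x' - Φ u := by exact_mod_cast h1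
    nlinarith
  have hne := cSet_nonempty Ψ Φ hΦ.continuous hE hΨ0 u₀ x₀ hx₀
  have hbd : ∀ lam, 1 ≤ lam → ∀ m ∈ cSet Ψ Φ u₀ x₀ lam, α₀ ≤ m := by
    rintro lam hlam m ⟨γ, hγ, hm⟩
    obtain ⟨t, ht⟩ := epath_cross Ψ Φ hΨnn u₀ x₀ ρ₀ α₀ hρ₀ hu₀ hsph lam hlam γ hγ
    exact ht.trans (hm t)
  have hbb : ∀ lam, 1 ≤ lam → BddBelow (cSet Ψ Φ u₀ x₀ lam) := fun lam h => ⟨α₀, hbd lam h⟩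
  set c : ℝ → ℝ := cE Ψ Φ u₀ x₀ with hc
  have hmono : MonotoneOn c (Ici 1) := by
    intro a ha b hb hab
    refine csInf_le_csInf (hbb a ha) (hne b) ?_
    rintro m ⟨γ, hγ, hm⟩
    refine ⟨γ, hγ, fun t => le_trans ?_ (hm t)⟩
    have := mul_le_mul_of_nonneg_right hab (epi_nonneg Ψ hΨnn (hγ.1 t))
    linarith
  have hx₀lam : ∀ lam ≤ 1 + ε, lam * x₀ - Φ u₀ ≤ 0 := by
    intro lam hlam
    have := mul_le_mul_of_nonneg_right hlam hx₀0
    linarith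
  -- existence of critical points at points of differentiability
  have hcritE : ∀ lam, 1 < lam → lam < 1 + ε → DifferentiableWithinAt ℝ c (Ici 1) lam →
      ∃ (w : X) (z : ℝ), Ψ w = (z : EReal) ∧ lam * z - Φ w = c lam ∧
      ∀ (v : X) (y : ℝ), Ψ v ≤ (y : EReal) → 0 ≤ lam * (y - z) - fderiv ℝ Φ w (v - w) := by
    intro lam hl1 hl2 hdiff
    have hd : DifferentiableAt ℝ c lam := hdiff.differentiableAt (Ici_mem_nhds hl1)
    obtain ⟨D, hDpos, hD⟩ := hd.hasDerivAt.isBigO_sub.exists_pos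
    rw [Asymptotics.isBigOWith_iff] at hD
    have hquot : ∀ τ > 0, ∃ μ, lam < μ ∧ μ < lam + τ ∧ c μ ≤ c lam + D * (μ - lam) := by
      intro τ hτ
      obtain ⟨r, hr, hball⟩ := Metric.eventually_nhds_iff.1 hD
      have hrm : 0 < min r τ := lt_min hr hτ
      have hm1 := min_le_left r τ
      have hm2 := min_le_right r τ
      refine ⟨lam + min r τ / 2, by linarith, by linarith, ?_⟩
      have := hball (y := lam + min r τ / 2) (by
        rw [Real.dist_eq, add_sub_cancel_left, abs_of_pos (by positivity)]; linarith)
      rw [Real.norm_eq_abs, Real.norm_eq_abs, add_sub_cancel_left,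
        abs_of_pos (show 0 < min r τ / 2 by positivity)] at this
      have := (le_abs_self _).trans this
      linarith
    obtain ⟨R, hR⟩ := hΨcoer (D + 3)
    have hR' : ∀ u : X, Ψ u ≤ ((D + 2 : ℝ) : EReal) → ‖u‖ ≤ R := by
      intro u hu
      by_contra hcon
      have h1 := (hR u (not_le.1 hcon).le).trans hu
      have h2 : D + 3 ≤ D + 2 := by exact_mod_cast h1
      linarith
    have hps := fun j : ℕ => ps_aux Ψ Φ hΨnn hEc hE hΦ u₀ x₀ α₀ R D lam hα₀ hl1.le hDpos.le hne
      (hbd lam hl1.le) hR' hΦ0 (hx₀lam lam hl2.le) hquot (1 / ((j : ℝ) + 2)) (by positivity)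
      (by rw [div_lt_one (by positivity)]; have : (0 : ℝ) ≤ j := j.cast_nonneg
          linarith)
    choose u x hx hu hcl hcr using hps
    have hδ : Tendsto (fun j : ℕ => 1 / ((j : ℝ) + 2)) atTop (𝓝 0) := by
      have := (tendsto_const_div_atTop_nhds_zero_nat (1 : ℝ)).comp (tendsto_add_atTop_nat 2)
      refine this.congr fun j => ?_
      simp
    refine limit_aux Ψ Φ hΨ0 hΨnn hEc hE hΨ3 hΦ hΦ2 lam (by linarith) (c lam) (fun _ => lam)
      (fun j : ℕ => 1 / ((j : ℝ) + 2)) u x tendsto_const_nhds hδ (fun j => by positivity) hx ?_ ?_ hcr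
    · refine isBounded_iff_forall_norm_le.2 ⟨R + 1, ?_⟩
      rintro _ ⟨j, rfl⟩
      exact hu j
    · rw [tendsto_iff_dist_tendsto_zero]
      exact squeeze_zero (fun _ => dist_nonneg) (fun j => by rw [Real.dist_eq]; exact hcl j) hδ
  -- choice of parameters decreasing to one
  have hdense : Dense {lam : ℝ | lam ∈ Ici (1 : ℝ) → DifferentiableWithinAt ℝ c (Ici 1) lam} :=
    MeasureTheory.Measure.dense_of_ae hmono.ae_differentiableWithinAt_of_mem
  have hlam : ∀ j : ℕ, ∃ lam, 1 < lam ∧ lam < 1 + ε ∧ lam < 1 + 1 / ((j : ℝ) + 1) ∧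
      DifferentiableWithinAt ℝ c (Ici 1) lam := by
    intro j
    have hpos : (0 : ℝ) < min ε (1 / ((j : ℝ) + 1)) := lt_min hε (by positivity)
    obtain ⟨lam, hl, hl1, hl2⟩ := hdense.exists_between
      (show (1 : ℝ) < 1 + min ε (1 / ((j : ℝ) + 1)) by linarith)
    have hm1 := min_le_left ε (1 / ((j : ℝ) + 1))
    have hm2 := min_le_right ε (1 / ((j : ℝ) + 1))
    exact ⟨lam, hl1, by linarith, by linarith, hl hl1.le⟩
  choose l hl1 hl2 hl3 hl4 using hlam
  have hltend : Tendsto l atTop (𝓝 1) := by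
    have h1 : Tendsto (fun j : ℕ => 1 + 1 / ((j : ℝ) + 1)) atTop (𝓝 (1 + 0)) :=
      tendsto_one_div_add_atTop_nhds_zero_nat.const_add 1
    rw [add_zero] at h1
    exact tendsto_of_tendsto_of_tendsto_of_le_of_le tendsto_const_nhds h1
      (fun j => (hl1 j).le) (fun j => (hl3 j).le)
  have hctend : Tendsto (fun j => c (l j)) atTop (𝓝 (c 1)) := by
    refine tendsto_order.2 ⟨fun a ha => ?_, fun a ha => ?_⟩
    · exact Eventually.of_forall fun j => ha.trans_le
        (hmono (mem_Ici.2 le_rfl) (mem_Ici.2 (hl1 j).le) (hl1 j).le)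
    · obtain ⟨m, ⟨γ, hγ, hm⟩, hma⟩ := exists_lt_of_csInf_lt (hne 1) ha
      have hcont : Continuous fun t => (γ t).2 := by fun_prop
      obtain ⟨B, hB⟩ := (isCompact_range hcont).bddAbove
      have h1 : Tendsto (fun j => m + (l j - 1) * B) atTop (𝓝 (m + (1 - 1) * B)) :=
        ((hltend.sub_const 1).mul_const B).const_add m
      rw [sub_self, zero_mul, add_zero] at h1
      filter_upwards [h1.eventually_lt_const hma] with j hj
      refine lt_of_le_of_lt (csInf_le (hbb _ (hl1 j).le) ⟨γ, hγ, fun t => ?_⟩) hj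
      have h2 := hm t
      have h3 := mul_le_mul_of_nonneg_left (hB ⟨t, rfl⟩ : (γ t).2 ≤ B)
        (sub_nonneg.2 (hl1 j).le)
      linarith
  choose u x hx hcx hcr using fun j => hcritE (l j) (hl1 j) (hl2 j) (hl4 j)
  have hbdd : IsBounded (range u) := by
    refine (hIB 1 (1 + ε) (c (1 + ε)) one_pos (by linarith)).subset ?_
    rintro _ ⟨j, rfl⟩
    refine ⟨l j, ⟨(hl1 j).le, (hl2 j).le⟩,
      isCrit_of_real Ψ Φ (l j) (by linarith [hl1 j]) hΨnn (u j) (x j) (hx j) (hcr j), ?_⟩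
    rw [ILam_coe Ψ Φ (l j) (u j) (x j) (hx j), hcx j]
    exact_mod_cast hmono (mem_Ici.2 (hl1 j).le) (mem_Ici.2 (by linarith)) (hl2 j).le
  obtain ⟨w, z, hw, hz, hcrit⟩ := limit_aux Ψ Φ hΨ0 hΨnn hEc hE hΨ3 hΦ hΦ2 1 one_pos (c 1) l
    (fun _ => 0) u x hltend tendsto_const_nhds (fun _ => le_rfl) hx hbdd
    (by simpa only [hcx] using hctend) (fun j v y hv => by simpa using hcr j v y hv)
  refine ⟨w, isCrit_of_real Ψ Φ 1 one_pos hΨnn w z hw hcrit, ?_⟩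
  rw [ILam_coe Ψ Φ 1 w z hw, hz, mp_cSet_eq Ψ Φ hΦ.continuous hΨnn hΨ0 u₀ x₀ hx₀]

end
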